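/- There do not exist real numbers θ_a, θ_b, θ_c, all strictly positive with θ_a + θ_b + θ_c = 1, satisfying simultaneously the three equations: θ_c = θ_c(1−(1−θ_c)²) + θ_b·θ_c² + θ_a·θ_c²; θ_b = θ_c·θ_b² + θ_b(1−(1−θ_b)²) + θ_a(θ_b² + 2θ_b·θ_c); θ_a = θ_c(θ_a² + 2θ_a·θ_b) + θ_b(θ_a² + 2θ_a·θ_c) + θ_a(1−(1−θ_a)²). -/

import Mathlib

theorem stmt_11 :
    ¬ ∃ θa θb θc : ℝ, 0 < θa ∧ 0 < θb ∧ 0 < θc ∧ θa + θb + θc = 1 ∧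
      θc = θc * (1 - (1 - θc) ^ 2) + θb * θc ^ 2 + θa * θc ^ 2 ∧
      θb = θc * θb ^ 2 + θb * (1 - (1 - θb) ^ 2) + θa * (θb ^ 2 + 2 * θb * θc) ∧
      θa = θc * (θa ^ 2 + 2 * θa * θb) + θb * (θa ^ 2 + 2 * θa * θc) +
        θa * (1 - (1 - θa) ^ 2) := by
  rintro ⟨a, b, c, ha, hb, hc, hsum, hC, hB, -⟩
  obtain rfl : a = 1 - b - c := by linarith
  have hc_half : c = 1 / 2 := by
    have h : c * (1 - c) * (1 - 2 * c) = 0 := by linear_combination hC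
    have hne : c * (1 - c) ≠ 0 := (mul_pos hc (by linarith)).ne'
    linarith [(mul_eq_zero.mp h).resolve_left hne]
  subst hc_half
  have h : b * (1 / 2 - b) * (1 - 2 * b) = 0 := by linear_combination hB
  have hne : b * (1 / 2 - b) ≠ 0 := (mul_pos hb (by linarith)).ne'
  linarith [(mul_eq_zero.mp h).resolve_left hne]
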